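/- Let Γ be a group and (C_i)_{i ∈ ℕ} a sequence of subsets of Γ such that each C_i is generic (finitely many left translates of C_i cover Γ) and symmetric (1 ∈ C_i and C_i⁻¹ = C_i), and C_{i+1}·C_{i+1} ⊆ C_i for every i. Then H := ⋂_{i ∈ ℕ} C_i is a subgroup of Γ, and its index is at most the continuum: the cardinality of the set of left cosets Γ/H is at most 2^{ℵ₀}. -/

import Mathlib

open Pointwise

/-- A subset `D` of a group `Γ` is generic if finitely many left translates of `D` cover `Γ`. -/
def IsGeneric {Γ : Type*} [Group Γ] (D : Set Γ) : Prop :=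
  ∃ F : Finset Γ, ∀ g : Γ, ∃ h ∈ F, h⁻¹ * g ∈ D

open Cardinal in
/-- A countable product of finite sets has cardinality at most the continuum. -/
theorem mk_pi_finset_le_two_power_aleph0 {α : Type*} (F : ℕ → Finset α) :
    #(∀ i, F i) ≤ 2 ^ ℵ₀ :=
  calc #(∀ i, F i) = Cardinal.prod fun i => #(F i) := mk_pi _
    _ ≤ Cardinal.prod fun _ : ℕ => ℵ₀ := prod_le_prod _ _ fun _ => mk_le_aleph0
    _ = 2 ^ ℵ₀ := by simp

/-- The intersection of a chain of symmetric sets with `C (i + 1) * C (i + 1) ⊆ C i`,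
as a subgroup. -/
def chainInterSubgroup {Γ : Type*} [Group Γ] (C : ℕ → Set Γ)
    (hone : ∀ i, (1 : Γ) ∈ C i) (hsymm : ∀ i, (C i)⁻¹ = C i)
    (hsq : ∀ i, C (i + 1) * C (i + 1) ⊆ C i) : Subgroup Γ where
  carrier := ⋂ i, C i
  one_mem' := Set.mem_iInter.2 hone
  mul_mem' ha hb := Set.mem_iInter.2 fun i =>
    hsq i (Set.mul_mem_mul (Set.mem_iInter.1 ha (i + 1)) (Set.mem_iInter.1 hb (i + 1)))
  inv_mem' ha := Set.mem_iInter.2 fun i => by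
    rw [← hsymm i]
    exact Set.inv_mem_inv.2 (Set.mem_iInter.1 ha i)

/-- Corollary 4.28 (group-theoretic content): the intersection of a decreasing chain
`C₀ ⊇ C₁² ⊇ …` of generic symmetric subsets with `C_{i+1}·C_{i+1} ⊆ C_i` is a subgroup
of index at most `2^ℵ₀`. -/
theorem inter_chain_subgroup_bounded_index {Γ : Type*} [Group Γ] (C : ℕ → Set Γ)
    (hgen : ∀ i, IsGeneric (C i))
    (hone : ∀ i, (1 : Γ) ∈ C i) (hsymm : ∀ i, (C i)⁻¹ = C i)
    (hsq : ∀ i, C (i + 1) * C (i + 1) ⊆ C i) :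
    ∃ H : Subgroup Γ, (H : Set Γ) = ⋂ i, C i ∧
      Cardinal.mk (Γ ⧸ H) ≤ 2 ^ Cardinal.aleph0 := by
  refine ⟨chainInterSubgroup C hone hsymm hsq, rfl, ?_⟩
  choose F t htF htC using hgen
  refine le_trans (Cardinal.mk_le_of_injective
    (f := fun q i => (⟨t i q.out, htF i q.out⟩ : F i)) fun p q hpq => ?_)
    (mk_pi_finset_le_two_power_aleph0 F)
  rw [← p.out_eq', ← q.out_eq', QuotientGroup.eq]
  refine Set.mem_iInter.2 fun i => hsq i ?_
  have ht : t (i + 1) p.out = t (i + 1) q.out := congrArg Subtype.val (congrFun hpq (i + 1))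
  have hp : ((t (i + 1) p.out)⁻¹ * p.out)⁻¹ ∈ C (i + 1) := by
    rw [← hsymm (i + 1)]
    exact Set.inv_mem_inv.2 (htC (i + 1) p.out)
  convert Set.mul_mem_mul hp (htC (i + 1) q.out) using 1
  rw [ht]
  group
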